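/- arXiv:math/0402084 — 9 statements merged into one kernel-verified Lean document; each statement's English description precedes it below -/
import Mathlib

section
/- Let K be a field and fix scalars α, β, γ, δ, α', β', γ', δ' ∈ K. Consider the relation (Rel): α(x≺y)≺z + β(x≺y)≻z + γ(x≻y)≺z + δ(x≻y)≻z = α' x≺(y≺z) + β' x≺(y≻z) + γ' x≻(y≺z) + δ' x≻(y≻z). Then the following are equivalent: (i) for every K-vector space A with two bilinear operations ≺, ≻ satisfying (Rel) for all x, y, z ∈ A, the extension of ≺ and ≻ to A₊ := K·1 ⊕ A defined by 1≺a = 0, 1≻a = a, a≺1 = a, a≻1 = 0 (a ∈ A) satisfies (Rel) for every triple (x, y, z) in which exactly one entry equals 1 and the other two lie in A; (ii) α = α' = β', β = δ = δ', and γ = γ'; that is, (Rel) is the linear combination α·(R1) + γ·(R2) + β·(R3). -/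
universe u

/-- The bilinear product `(a, b) ↦ (0, i (a.1 * b.1))` on `K × M`, for a linear map `i : K → M`.
Since its values have vanishing first component, all threefold products of such operations
are zero. -/
def fstMulFst {K : Type*} [Field K] {M : Type*} [AddCommGroup M] [Module K M] (i : K →ₗ[K] M) :
    K × M →ₗ[K] K × M →ₗ[K] K × M :=
  ((LinearMap.mul K K).compl₁₂ (LinearMap.fst K K M) (LinearMap.fst K K M)).compr₂
    (LinearMap.inr K K M ∘ₗ i)

@[simp]
theorem fstMulFst_apply {K : Type*} [Field K] {M : Type*} [AddCommGroup M] [Module K M]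
    (i : K →ₗ[K] M) (a b : K × M) : fstMulFst i a b = (0, i (a.1 * b.1)) :=
  rfl

/-- Compatibility of a quadratic relation with the unit action
`1 ≺ a = 0, 1 ≻ a = a, a ≺ 1 = a, a ≻ 1 = 0` holds for all algebras satisfying the relation
if and only if the relation is the linear combination `α·(R1) + γ·(R2) + β·(R3)` of the
dendriform relations.  The conditions obtained by substituting `1` for exactly one of the
variables `x`, `y`, `z` (the other two being in `A`) are written out explicitly using the
unit action. -/
theorem compatibility_iff_dendriform_combination
    (K : Type u) [Field K] (α β γ δ α' β' γ' δ' : K) :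
    (∀ (A : Type u) [AddCommGroup A] [Module K A] (p s : A →ₗ[K] A →ₗ[K] A),
      (∀ x y z : A,
        α • p (p x y) z + β • s (p x y) z + γ • p (s x y) z + δ • s (s x y) z
          = α' • p x (p y z) + β' • p x (s y z) + γ' • s x (p y z) + δ' • s x (s y z)) →
      ((∀ y z : A,
          γ • p y z + δ • s y z = γ' • p y z + δ' • s y z) ∧
       (∀ x z : A,
          α • p x z + β • s x z = β' • p x z + δ' • s x z) ∧
       (∀ x y : A,
          α • p x y + γ • s x y = α' • p x y + γ' • s x y)))
    ↔ (α = α' ∧ α = β' ∧ β = δ ∧ β = δ' ∧ γ = γ') := by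
  constructor
  · intro h
    obtain ⟨hx, hy, hz⟩ := h (K × K × K) (fstMulFst (LinearMap.inl K K K))
      (fstMulFst (LinearMap.inr K K K)) (by intro x y z; simp)
    have hx := hx (1, 0, 0) (1, 0, 0)
    have hy := hy (1, 0, 0) (1, 0, 0)
    have hz := hz (1, 0, 0) (1, 0, 0)
    simp only [fstMulFst_apply, LinearMap.inl_apply, LinearMap.inr_apply, Prod.smul_mk,
      Prod.mk_add_mk, smul_eq_mul, mul_one, mul_zero, add_zero, zero_add, Prod.mk.injEq,
      true_and] at hx hy hz
    exact ⟨hz.1, hy.1, hy.2.trans hx.2.symm, hy.2, hx.1⟩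
  · rintro ⟨rfl, rfl, rfl, rfl, rfl⟩ A _ _ p s _
    exact ⟨fun _ _ => rfl, fun _ _ => rfl, fun _ _ => rfl⟩
end

section
/- Let K be a field and α, β, γ ∈ K. Say a K-vector space with bilinear operations ≺, ≻ satisfies R(α,β,γ) if α[(x≺y)≺z − x≺(y≺z) − x≺(y≻z)] + γ[(x≻y)≺z − x≻(y≺z)] + β[(x≺y)≻z + (x≻y)≻z − x≻(y≻z)] = 0 for all x, y, z. Let A and B be K-vector spaces with bilinear operations ≺, ≻ each satisfying R(α,β,γ) and also R(1,1,1) (so x*y := x≺y + x≻y is associative on A and on B). Define on M := A ⊕ B ⊕ (A ⊗_K B) the bilinear operations ≺, ≻ determined, for a, a' ∈ A and b, b' ∈ B and for ∘ ∈ {≺, ≻}, by: a∘a' and b∘b' as in A, resp. B; a≺b' := 0, a≻b' := a⊗b', b≺a' := a'⊗b, b≻a' := 0; a≺(a'⊗b') := 0, a≻(a'⊗b') := (a*a')⊗b'; (a⊗b)≺a' := (a*a')⊗b, (a⊗b)≻a' := 0; b∘(a'⊗b') := a'⊗(b∘b'); (a⊗b)∘b' := a⊗(b∘b'); (a⊗b)∘(a'⊗b')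 := (a*a')⊗(b∘b'). Then M satisfies R(α,β,γ), and M also satisfies R(1,1,1) (so *_M is associative). -/
open TensorProduct

/-- An additively closed predicate on `A × B × (A ⊗ B)` that holds on elements of `A`, elements of
`B` and pure tensors holds everywhere. -/
theorem prod_tensor_induction {K A B : Type*} [CommSemiring K] [AddCommMonoid A] [Module K A]
    [AddCommMonoid B] [Module K B] {P : A × B × (A ⊗[K] B) → Prop}
    (left : ∀ a, P (a, 0, 0)) (right : ∀ b, P (0, b, 0)) (tmul : ∀ a b, P (0, 0, a ⊗ₜ[K] b))
    (add : ∀ x y, P x → P y → P (x + y)) (x : A × B × (A ⊗[K] B)) : P x := by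
  obtain ⟨a, b, t⟩ := x
  have tensor : P (0, 0, t) := by
    induction t using TensorProduct.induction_on with
    | zero => exact left 0
    | tmul a b => exact tmul a b
    | add t u ht hu => simpa using add _ _ ht hu
  simpa using add _ _ (left a) (add _ _ (right b) tensor)

/-- Coherence: if `A` and `B` satisfy the relation `R(α,β,γ) = α·(R1) + γ·(R2) + β·(R3)` and `R(1,1,1)` (associativity of `x * y = x ≺ y + x ≻ y`), then `M = A ⊕ B ⊕ (A ⊗ B)` with the operations induced by the unit action `1 ≺ x = 0, 1 ≻ x = x, x ≺ 1 = x, x ≻ 1 = 0` satisfies `R(α,β,γ)` and `R(1,1,1)`. -/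
theorem coherence_dendriform_type
    (K : Type*) [Field K]
    (A : Type*) [AddCommGroup A] [Module K A]
    (B : Type*) [AddCommGroup B] [Module K B]
    (α β γ : K)
    (pA sA : A →ₗ[K] A →ₗ[K] A)
    (pB sB : B →ₗ[K] B →ₗ[K] B)
    (pM sM : (A × B × (A ⊗[K] B)) →ₗ[K] (A × B × (A ⊗[K] B)) →ₗ[K] (A × B × (A ⊗[K] B)))
    (hA : ∀ x y z : A, α • (pA (pA x y) z - pA x (pA y z) - pA x (sA y z)) + γ • (pA (sA x y) z - sA x (pA y z)) + β • (sA (pA x y) z + sA (sA x y) z - sA x (sA y z)) = 0)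
    (hA1 : ∀ x y z : A, (pA (pA x y) z - pA x (pA y z) - pA x (sA y z)) + (pA (sA x y) z - sA x (pA y z)) + (sA (pA x y) z + sA (sA x y) z - sA x (sA y z)) = 0)
    (hB : ∀ x y z : B, α • (pB (pB x y) z - pB x (pB y z) - pB x (sB y z)) + γ • (pB (sB x y) z - sB x (pB y z)) + β • (sB (pB x y) z + sB (sB x y) z - sB x (sB y z)) = 0)
    (hB1 : ∀ x y z : B, (pB (pB x y) z - pB x (pB y z) - pB x (sB y z)) + (pB (sB x y) z - sB x (pB y z)) + (sB (pB x y) z + sB (sB x y) z - sB x (sB y z)) = 0)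
    (hpAA : ∀ a a' : A, pM (a, 0, 0) (a', 0, 0) = (pA a a', 0, 0))
    (hpBB : ∀ b b' : B, pM (0, b, 0) (0, b', 0) = (0, pB b b', 0))
    (hpAB : ∀ (a : A) (b' : B), pM (a, 0, 0) (0, b', 0) = 0)
    (hpBA : ∀ (b : B) (a' : A), pM (0, b, 0) (a', 0, 0) = (0, 0, a' ⊗ₜ[K] b))
    (hpAT : ∀ (a a' : A) (b' : B), pM (a, 0, 0) (0, 0, a' ⊗ₜ[K] b') = 0)
    (hpTA : ∀ (a a' : A) (b : B), pM (0, 0, a ⊗ₜ[K] b) (a', 0, 0) = (0, 0, (pA a a' + sA a a') ⊗ₜ[K] b))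
    (hpBT : ∀ (a' : A) (b b' : B), pM (0, b, 0) (0, 0, a' ⊗ₜ[K] b') = (0, 0, a' ⊗ₜ[K] (pB b b')))
    (hpTB : ∀ (a : A) (b b' : B), pM (0, 0, a ⊗ₜ[K] b) (0, b', 0) = (0, 0, a ⊗ₜ[K] (pB b b')))
    (hpTT : ∀ (a a' : A) (b b' : B), pM (0, 0, a ⊗ₜ[K] b) (0, 0, a' ⊗ₜ[K] b') = (0, 0, (pA a a' + sA a a') ⊗ₜ[K] (pB b b')))
    (hsAA : ∀ a a' : A, sM (a, 0, 0) (a', 0, 0) = (sA a a', 0, 0))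
    (hsBB : ∀ b b' : B, sM (0, b, 0) (0, b', 0) = (0, sB b b', 0))
    (hsAB : ∀ (a : A) (b' : B), sM (a, 0, 0) (0, b', 0) = (0, 0, a ⊗ₜ[K] b'))
    (hsBA : ∀ (b : B) (a' : A), sM (0, b, 0) (a', 0, 0) = 0)
    (hsAT : ∀ (a a' : A) (b' : B), sM (a, 0, 0) (0, 0, a' ⊗ₜ[K] b') = (0, 0, (pA a a' + sA a a') ⊗ₜ[K] b'))
    (hsTA : ∀ (a a' : A) (b : B), sM (0, 0, a ⊗ₜ[K] b) (a', 0, 0) = 0)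
    (hsBT : ∀ (a' : A) (b b' : B), sM (0, b, 0) (0, 0, a' ⊗ₜ[K] b') = (0, 0, a' ⊗ₜ[K] (sB b b')))
    (hsTB : ∀ (a : A) (b b' : B), sM (0, 0, a ⊗ₜ[K] b) (0, b', 0) = (0, 0, a ⊗ₜ[K] (sB b b')))
    (hsTT : ∀ (a a' : A) (b b' : B), sM (0, 0, a ⊗ₜ[K] b) (0, 0, a' ⊗ₜ[K] b') = (0, 0, (pA a a' + sA a a') ⊗ₜ[K] (sB b b'))) :
    (∀ x y z : (A × B × (A ⊗[K] B)), α • (pM (pM x y) z - pM x (pM y z) - pM x (sM y z)) + γ • (pM (sM x y) z - sM x (pM y z)) + β • (sM (pM x y) z + sM (sM x y) z - sM x (sM y z)) = 0) ∧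
    (∀ x y z : (A × B × (A ⊗[K] B)), (pM (pM x y) z - pM x (pM y z) - pM x (sM y z)) + (pM (sM x y) z - sM x (pM y z)) + (sM (pM x y) z + sM (sM x y) z - sM x (sM y z)) = 0) := by
  have mk_zero : ((0, 0, 0) : A × B × (A ⊗[K] B)) = 0 := rfl
  obtain ⟨mA, hm⟩ : ∃ mA : A →ₗ[K] A →ₗ[K] A, ∀ x y, pA x y + sA x y = mA x y :=
    ⟨pA + sA, fun _ _ => rfl⟩
  have assoc (x y z : A) : mA (mA x y) z = mA x (mA y z) := by
    simp only [← hm, map_add, LinearMap.add_apply]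
    linear_combination (norm := module) hA1 x y z
  have hpm (x y : A) : pA x y = mA x y - sA x y := by rw [← hm, add_sub_cancel_right]
  simp only [hm] at hpTA hpTT hsAT hsTT
  have key (α β γ : K)
      (hA : ∀ x y z : A, α • (pA (pA x y) z - pA x (pA y z) - pA x (sA y z)) +
        γ • (pA (sA x y) z - sA x (pA y z)) +
        β • (sA (pA x y) z + sA (sA x y) z - sA x (sA y z)) = 0)
      (hB : ∀ x y z : B, α • (pB (pB x y) z - pB x (pB y z) - pB x (sB y z)) +
        γ • (pB (sB x y) z - sB x (pB y z)) +
        β • (sB (pB x y) z + sB (sB x y) z - sB x (sB y z)) = 0)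
      (x y z : A × B × (A ⊗[K] B)) :
      α • (pM (pM x y) z - pM x (pM y z) - pM x (sM y z)) +
        γ • (pM (sM x y) z - sM x (pM y z)) +
        β • (sM (pM x y) z + sM (sM x y) z - sM x (sM y z)) = 0 := by
    have hT (a : A) (x y z : B) := congrArg (fun b => a ⊗ₜ[K] b) (hB x y z)
    simp only [tmul_add, tmul_sub, tmul_smul, tmul_zero] at hT
    induction x using prod_tensor_induction with
    | add x x' hx hx' =>
      simp only [map_add, LinearMap.add_apply]
      linear_combination (norm := module) hx + hx'
    | _ =>
      induction y using prod_tensor_induction with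
      | add y y' hy hy' =>
        simp only [map_add, LinearMap.add_apply]
        linear_combination (norm := module) hy + hy'
      | _ =>
        induction z using prod_tensor_induction with
        | add z z' hz hz' =>
          simp only [map_add]
          linear_combination (norm := module) hz + hz'
        | _ =>
          simp only [hpAA, hpBB, hpAB, hpBA, hpAT, hpTA, hpBT, hpTB, hpTT, hsAA, hsBB, hsAB, hsBA,
            hsAT, hsTA, hsBT, hsTB, hsTT, map_zero, LinearMap.zero_apply, Prod.mk_sub_mk,
            Prod.mk_add_mk, Prod.smul_mk, sub_zero, add_zero, smul_zero, zero_sub, zero_add,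
            sub_self, hA, hB, hT, assoc, mk_zero]
          try simp [hpm, assoc, sub_tmul]
  refine ⟨key α β γ hA hB, ?_⟩
  simpa only [one_smul] using
    key 1 1 1 (by simpa only [one_smul] using hA1) (by simpa only [one_smul] using hB1)
end

section
/- Let K be a field and H a bialgebra over K with multiplication m, unit 1, comultiplication Δ and counit ε. Define an increasing family of subspaces of H by F₀ := K·1 and, for r ≥ 1, F_r := { x ∈ H | Δ(x) − 1⊗x − x⊗1 lies in the image of F_{r−1} ⊗ F_{r−1} in H ⊗ H }. If H = ⋃_{r≥0} F_r (H is connected), then H admits an antipode: there exists a K-linear map S : H → H such that m ∘ (S ⊗ id) ∘ Δ = 1·ε = m ∘ (id ⊗ S) ∘ Δ; that is, H is a Hopf algebra. -/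
open TensorProduct

/-- A locally nilpotent element `e` of a convolution algebra makes `1 - e` invertible, with inverse
the pointwise finite geometric series `∑ k, e ^ k`. -/
theorem exists_convMul_inverse_one_sub {R C A : Type*} [CommRing R] [AddCommGroup C] [Module R C]
    [Coalgebra R C] [Ring A] [Algebra R A] (e : WithConv (C →ₗ[R] A))
    (he : ∀ x : C, ∃ n, ∀ k, n ≤ k → (e ^ k) x = 0) :
    ∃ S : WithConv (C →ₗ[R] A), S * (1 - e) = 1 ∧ (1 - e) * S = 1 := by
  have hfin (x : C) : (Function.support fun k => (e ^ k) x).Finite := by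
    obtain ⟨n, hn⟩ := he x
    refine (Set.finite_lt_nat n).subset fun k hk => ?_
    by_contra h
    exact hk (hn k (not_lt.mp h))
  let S : WithConv (C →ₗ[R] A) := WithConv.toConv
    { toFun := fun x => ∑ᶠ k, (e ^ k) x
      map_add' := fun x y => by
        rw [← finsum_add_distrib (hfin x) (hfin y)]
        exact finsum_congr fun k => map_add (e ^ k).ofConv x y
      map_smul' := fun c x => by
        rw [RingHom.id_apply, smul_finsum' c (hfin x)]
        exact finsum_congr fun k => map_smul (e ^ k).ofConv c x }
  have hS (x : C) : ∀ᶠ n in Filter.atTop, S x = (∑ k ∈ Finset.range n, e ^ k) x := by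
    obtain ⟨N, hN⟩ := he x
    filter_upwards [Filter.eventually_ge_atTop N] with n hn
    have hsum : (∑ k ∈ Finset.range n, e ^ k) x = ∑ k ∈ Finset.range n, (e ^ k) x := by
      induction n with
      | zero => simp
      | succ n ih => simp [Finset.sum_range_succ]
    rw [hsum]
    refine finsum_eq_sum_of_support_subset _ fun k hk => ?_
    by_contra h
    exact hk (hN k (hn.trans (by simpa using h)))
  have he' (x : C) : ∀ᶠ n in Filter.atTop, (e ^ n) x = 0 :=
    Filter.eventually_atTop.mpr (he x)
  refine ⟨S, ?_, ?_⟩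
  all_goals
    ext x
    let r := Coalgebra.Repr.arbitrary R x
    obtain ⟨n, hl, hr, hn⟩ := ((Filter.eventually_all_finset r.index).mpr
      fun i _ => hS (r.left i)).and (((Filter.eventually_all_finset r.index).mpr
      fun i _ => hS (r.right i)).and (he' x)) |>.exists
  · calc (S * (1 - e)) x = ((∑ k ∈ Finset.range n, e ^ k) * (1 - e)) x := by
          rw [r.convMul_apply, r.convMul_apply]
          exact Finset.sum_congr rfl fun i hi => by rw [hl i hi]
      _ = (1 : WithConv (C →ₗ[R] A)) x - (e ^ n) x := by rw [geom_sum_mul_neg]; rfl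
      _ = (1 : WithConv (C →ₗ[R] A)) x := by rw [hn, sub_zero]
  · calc ((1 - e) * S) x = ((1 - e) * ∑ k ∈ Finset.range n, e ^ k) x := by
          rw [r.convMul_apply, r.convMul_apply]
          exact Finset.sum_congr rfl fun i hi => by rw [hr i hi]
      _ = (1 : WithConv (C →ₗ[R] A)) x - (e ^ n) x := by rw [mul_neg_geom_sum]; rfl
      _ = (1 : WithConv (C →ₗ[R] A)) x := by rw [hn, sub_zero]

/-- If `f` and `g` vanish at `1` and `g` vanishes on `F`, then the convolution product `f * g` kills
every `x` with `Δ(x) - 1 ⊗ x - x ⊗ 1` in the image of `F ⊗ F`. -/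
theorem convMul_apply_eq_zero_of_reduced_comul_mem {R H : Type*} [CommRing R] [Ring H]
    [Bialgebra R H] {F : Submodule R H} {f g : WithConv (H →ₗ[R] H)} (hf : f 1 = 0)
    (hg : g 1 = 0) (hgF : ∀ y ∈ F, g y = 0) {x : H}
    (hx : Coalgebra.comul (R := R) x - (1 : H) ⊗ₜ[R] x - x ⊗ₜ[R] (1 : H)
      ∈ LinearMap.range (TensorProduct.map F.subtype F.subtype)) :
    (f * g) x = 0 := by
  obtain ⟨t, ht⟩ := hx
  have hzero : TensorProduct.map f.ofConv g.ofConv ∘ₗ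
      TensorProduct.map F.subtype F.subtype = 0 := by
    rw [← TensorProduct.map_comp,
      show g.ofConv ∘ₗ F.subtype = 0 from LinearMap.ext fun y => hgF y y.2,
      TensorProduct.map_zero_right]
  have hker := LinearMap.congr_fun hzero t
  rw [LinearMap.comp_apply, ht, map_sub, map_sub, TensorProduct.map_tmul, TensorProduct.map_tmul,
    show f.ofConv 1 = 0 from hf, show g.ofConv 1 = 0 from hg, TensorProduct.zero_tmul,
    TensorProduct.tmul_zero, sub_zero, sub_zero, LinearMap.zero_apply] at hker
  rw [LinearMap.convMul_apply, hker, map_zero]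

/-- A connected bialgebra admits an antipode, i.e. is a Hopf algebra: if the filtration
`F₀ = K·1`, `F_{r+1} = {x | Δ(x) − 1⊗x − x⊗1 ∈ im(F_r ⊗ F_r)}` is exhaustive, then there is
a linear map `S : H → H` with `m ∘ (S ⊗ id) ∘ Δ = 1·ε = m ∘ (id ⊗ S) ∘ Δ`. -/
theorem connected_bialgebra_has_antipode
    (K : Type*) [Field K] (H : Type*) [Ring H] [Bialgebra K H]
    (F : ℕ → Submodule K H)
    (hF0 : F 0 = Submodule.span K {(1 : H)})
    (hFsucc : ∀ (r : ℕ) (x : H), x ∈ F (r + 1) ↔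
      Coalgebra.comul (R := K) x - (1 : H) ⊗ₜ[K] x - x ⊗ₜ[K] (1 : H)
        ∈ LinearMap.range (TensorProduct.map (F r).subtype (F r).subtype))
    (hconn : ∀ x : H, ∃ r, x ∈ F r) :
    ∃ S : H →ₗ[K] H,
      LinearMap.mul' K H ∘ₗ TensorProduct.map S LinearMap.id ∘ₗ Coalgebra.comul
          = Algebra.linearMap K H ∘ₗ Coalgebra.counit ∧
      LinearMap.mul' K H ∘ₗ TensorProduct.map LinearMap.id S ∘ₗ Coalgebra.comul
          = Algebra.linearMap K H ∘ₗ Coalgebra.counit := by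
  let I : WithConv (H →ₗ[K] H) := WithConv.toConv LinearMap.id
  let e : WithConv (H →ₗ[K] H) := 1 - I
  have he1 : e 1 = 0 := by
    change algebraMap K H (Coalgebra.counit (R := K) (1 : H)) - 1 = 0
    simp
  have hpow1 (k : ℕ) : (e ^ (k + 1)) 1 = 0 := by
    rw [pow_succ', LinearMap.convMul_apply, Bialgebra.comul_one, Algebra.TensorProduct.one_def,
      TensorProduct.map_tmul, LinearMap.mul'_apply]
    exact mul_eq_zero_of_left he1 _
  have hnil (r : ℕ) : ∀ k, ∀ x ∈ F r, (e ^ (r + k + 1)) x = 0 := by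
    induction r with
    | zero =>
      intro k x hx
      rw [hF0] at hx
      obtain ⟨c, rfl⟩ := Submodule.mem_span_singleton.mp hx
      exact (map_smul (e ^ (0 + k + 1)).ofConv c 1).trans
        ((congrArg (c • ·) (hpow1 (0 + k))).trans (smul_zero c))
    | succ r ih =>
      intro k x hx
      rw [show r + 1 + k + 1 = (r + k + 1) + 1 by ring, pow_succ']
      exact convMul_apply_eq_zero_of_reduced_comul_mem he1 (hpow1 _) (ih k) ((hFsucc r x).mp hx)
  obtain ⟨S, hl, hr⟩ := exists_convMul_inverse_one_sub e fun x => by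
    obtain ⟨r, hx⟩ := hconn x
    refine ⟨r + 1, fun k hk => ?_⟩
    obtain ⟨j, rfl⟩ := Nat.exists_eq_add_of_le hk
    rw [add_right_comm]
    exact hnil r j x hx
  rw [show 1 - e = I from sub_sub_cancel 1 I] at hl hr
  exact ⟨S.ofConv, congrArg WithConv.ofConv hl, congrArg WithConv.ofConv hr⟩
end

section
/- Let K be a field, let (C, Δ) be a coassociative K-coalgebra, and let (A, ≺, ≻) be a dendriform algebra over K. For K-linear maps f, g : C → A define f ≺̄ g := ≺ ∘ (f ⊗ g) ∘ Δ and f ≻̄ g := ≻ ∘ (f ⊗ g) ∘ Δ (convolution-type operations). Then Hom_K(C, A) equipped with ≺̄ and ≻̄ is a dendriform algebra, i.e., these bilinear operations satisfy the relations (R1), (R2), (R3). -/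
open TensorProduct

/-- The convolution-type operation `f ∘̄ g := ∘ ∘ (f ⊗ g) ∘ Δ` on linear maps from a
coalgebra to an algebra with a binary operation `∘`. -/
noncomputable def convOp {K C A : Type*} [Field K] [AddCommGroup C] [Module K C]
    [AddCommGroup A] [Module K A] (Δ : C →ₗ[K] C ⊗[K] C)
    (q : A →ₗ[K] A →ₗ[K] A) (f g : C →ₗ[K] A) : C →ₗ[K] A :=
  TensorProduct.lift q ∘ₗ TensorProduct.map f g ∘ₗ Δ

section

variable {K C A : Type*} [Field K] [AddCommGroup C] [Module K C] [AddCommGroup A] [Module K A]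

theorem convOp_convOp_right (Δ : C →ₗ[K] C ⊗[K] C) (q r : A →ₗ[K] A →ₗ[K] A)
    (f g h : C →ₗ[K] A) :
    convOp Δ q f (convOp Δ r g h)
      = (TensorProduct.lift q ∘ₗ
          TensorProduct.map f (TensorProduct.lift r ∘ₗ TensorProduct.map g h)) ∘ₗ
        (TensorProduct.map LinearMap.id Δ ∘ₗ Δ) := by
  have key : TensorProduct.map f ((TensorProduct.lift r ∘ₗ TensorProduct.map g h) ∘ₗ Δ)
      = TensorProduct.map f (TensorProduct.lift r ∘ₗ TensorProduct.map g h) ∘ₗ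
        TensorProduct.map LinearMap.id Δ := by
    rw [← TensorProduct.map_comp, LinearMap.comp_id]
  simp only [convOp, ← LinearMap.comp_assoc] at key ⊢
  rw [LinearMap.comp_assoc (TensorProduct.map LinearMap.id Δ), ← key]

/-- By coassociativity, a left-nested convolution factors through the same iterated coproduct
`(id ⊗ Δ) ∘ Δ` as a right-nested one. -/
theorem convOp_convOp_left {Δ : C →ₗ[K] C ⊗[K] C}
    (coassoc : (TensorProduct.assoc K C C C).toLinearMap
        ∘ₗ TensorProduct.map Δ LinearMap.id ∘ₗ Δ
      = TensorProduct.map LinearMap.id Δ ∘ₗ Δ)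
    (q r : A →ₗ[K] A →ₗ[K] A) (f g h : C →ₗ[K] A) :
    convOp Δ q (convOp Δ r f g) h
      = (TensorProduct.lift q ∘ₗ
          TensorProduct.map (TensorProduct.lift r ∘ₗ TensorProduct.map f g) h ∘ₗ
          (TensorProduct.assoc K C C C).symm.toLinearMap) ∘ₗ
        (TensorProduct.map LinearMap.id Δ ∘ₗ Δ) := by
  have key : TensorProduct.map ((TensorProduct.lift r ∘ₗ TensorProduct.map f g) ∘ₗ Δ) h
      = TensorProduct.map (TensorProduct.lift r ∘ₗ TensorProduct.map f g) h ∘ₗ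
        TensorProduct.map Δ LinearMap.id := by
    rw [← TensorProduct.map_comp, LinearMap.comp_id]
  rw [← coassoc]
  ext c
  simpa [convOp, LinearMap.comp_assoc] using
    congrArg (TensorProduct.lift q) (LinearMap.congr_fun key (Δ c))

end

/-- If `(C, Δ)` is a coassociative coalgebra and `(A, ≺, ≻)` a dendriform algebra, then
`Hom_K(C, A)` with the convolution operations `≺̄`, `≻̄` is a dendriform algebra. -/
theorem convolution_dendriform
    (K : Type*) [Field K]
    (C : Type*) [AddCommGroup C] [Module K C]
    (A : Type*) [AddCommGroup A] [Module K A]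
    (Δ : C →ₗ[K] C ⊗[K] C)
    (coassoc : (TensorProduct.assoc K C C C).toLinearMap
        ∘ₗ TensorProduct.map Δ LinearMap.id ∘ₗ Δ
      = TensorProduct.map LinearMap.id Δ ∘ₗ Δ)
    (p s : A →ₗ[K] A →ₗ[K] A)
    (R1 : ∀ x y z : A, p (p x y) z = p x (p y z) + p x (s y z))
    (R2 : ∀ x y z : A, p (s x y) z = s x (p y z))
    (R3 : ∀ x y z : A, s (p x y) z + s (s x y) z = s x (s y z)) :
    (∀ f g h : C →ₗ[K] A,
      convOp Δ p (convOp Δ p f g) h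
        = convOp Δ p f (convOp Δ p g h) + convOp Δ p f (convOp Δ s g h)) ∧
    (∀ f g h : C →ₗ[K] A,
      convOp Δ p (convOp Δ s f g) h = convOp Δ s f (convOp Δ p g h)) ∧
    (∀ f g h : C →ₗ[K] A,
      convOp Δ s (convOp Δ p f g) h + convOp Δ s (convOp Δ s f g) h
        = convOp Δ s f (convOp Δ s g h)) := by
  simp only [convOp_convOp_left coassoc, convOp_convOp_right, ← LinearMap.add_comp]
  refine ⟨fun f g h => ?_, fun f g h => ?_, fun f g h => ?_⟩ <;> congr 1 <;> ext x y z
  · simpa using R1 (f x) (g y) (h z)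
  · simpa using R2 (f x) (g y) (h z)
  · simpa using R3 (f x) (g y) (h z)
end

section
/- Let K be a field and let A, B be dendriform trialgebras over K. Define on M := A ⊕ B ⊕ (A ⊗_K B) the bilinear operations determined, for a, a' ∈ A and b, b' ∈ B and for ∘ ∈ {≺, ≻, ·}, by: a∘a' and b∘b' as in A, resp. B; a≺b' := 0, a≻b' := a⊗b', a·b' := 0; b≺a' := a'⊗b, b≻a' := 0, b·a' := 0; a≺(a'⊗b') := 0, a≻(a'⊗b') := (a*a')⊗b', a·(a'⊗b') := 0; (a⊗b)≺a' := (a*a')⊗b, (a⊗b)≻a' := 0, (a⊗b)·a' := 0; b∘(a'⊗b') := a'⊗(b∘b'); (a⊗b)∘b' := a⊗(b∘b'); (a⊗b)∘(a'⊗b') := (a*a')⊗(b∘b'). Then M with these three operations is a dendriform trialgebra (satisfies relations (T1)–(T7)). -/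
open TensorProduct

/-- Two trilinear expressions built from bilinear maps on `A × B × (A ⊗ B)` agree as soon as they
agree on triples of generators. -/
theorem bilin_comp_eq_of_generators
    {K A B : Type*} [CommSemiring K] [AddCommMonoid A] [Module K A] [AddCommMonoid B] [Module K B]
    {f g h k : (A × B × (A ⊗[K] B)) →ₗ[K] (A × B × (A ⊗[K] B)) →ₗ[K] (A × B × (A ⊗[K] B))}
    {S : Set (A × B × (A ⊗[K] B))}
    (hA : ∀ a : A, (a, 0, 0) ∈ S) (hB : ∀ b : B, (0, b, 0) ∈ S)
    (hT : ∀ (a : A) (b : B), (0, 0, a ⊗ₜ[K] b) ∈ S)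
    (H : ∀ x ∈ S, ∀ y ∈ S, ∀ z ∈ S, f (g x y) z = h x (k y z)) (x y z : A × B × (A ⊗[K] B)) :
    f (g x y) z = h x (k y z) := by
  have hS : ∀ x, x ∈ Submodule.span K S := by
    rintro ⟨a, b, t⟩
    have ht : ((0, 0, t) : A × B × (A ⊗[K] B)) ∈ Submodule.span K S := by
      induction t with
      | zero => exact zero_mem _
      | tmul a b => exact Submodule.subset_span (hT a b)
      | add u v hu hv => simpa using add_mem hu hv
    simpa using add_mem (add_mem (Submodule.subset_span (hA a)) (Submodule.subset_span (hB b))) ht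
  induction hS x using Submodule.span_induction with
  | zero => simp
  | add u v _ _ hu hv => simp [hu, hv]
  | smul c u _ hu => simp [hu]
  | mem x hx =>
    induction hS y using Submodule.span_induction with
    | zero => simp
    | add u v _ _ hu hv => simp [hu, hv]
    | smul c u _ hu => simp [hu]
    | mem y hy =>
      induction hS z using Submodule.span_induction with
      | zero => simp
      | add u v _ _ hu hv => simp [hu, hv]
      | smul c u _ hu => simp [hu]
      | mem z hz => exact H x hx y hy z hz

/-- In a dendriform trialgebra the sum of the three operations is associative. -/
theorem tridendriform_star_assoc
    {K A : Type*} [CommSemiring K] [AddCommMonoid A] [Module K A] {p s d t : A →ₗ[K] A →ₗ[K] A}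
    (ht : ∀ x y, p x y + s x y + d x y = t x y)
    (h1 : ∀ x y z, p (p x y) z = p x (t y z)) (h2 : ∀ x y z, p (s x y) z = s x (p y z))
    (h3 : ∀ x y z, s (t x y) z = s x (s y z)) (h4 : ∀ x y z, d (s x y) z = s x (d y z))
    (h5 : ∀ x y z, d (p x y) z = d x (s y z)) (h6 : ∀ x y z, p (d x y) z = d x (p y z))
    (h7 : ∀ x y z, d (d x y) z = d x (d y z)) (x y z : A) :
    t (t x y) z = t x (t y z) := by
  rw [← ht (t x y), h3, ← ht x (t y z), ← h1, ← ht x y, ← ht y z]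
  simp only [map_add, LinearMap.add_apply, h2, h4, h5, h6, h7]
  abel

set_option maxHeartbeats 1600000 in
/-- Coherence for dendriform trialgebras: if `A` and `B` are dendriform trialgebras, then `M = A ⊕ B ⊕ (A ⊗ B)` with the operations induced by the unit action `1 ≺ x = 0, 1 ≻ x = x, x ≺ 1 = x, x ≻ 1 = 0, 1 · x = 0 = x · 1` is a dendriform trialgebra. -/
theorem coherence_tridendriform
    (K : Type*) [Field K]
    (A : Type*) [AddCommGroup A] [Module K A]
    (B : Type*) [AddCommGroup B] [Module K B]
    (pA sA dA : A →ₗ[K] A →ₗ[K] A)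
    (pB sB dB : B →ₗ[K] B →ₗ[K] B)
    (pM sM dM : (A × B × (A ⊗[K] B)) →ₗ[K] (A × B × (A ⊗[K] B)) →ₗ[K] (A × B × (A ⊗[K] B)))
    (hAT1 : ∀ x y z : A, pA (pA x y) z = pA x (pA y z + sA y z + dA y z))
    (hAT2 : ∀ x y z : A, pA (sA x y) z = sA x (pA y z))
    (hAT3 : ∀ x y z : A, sA (pA x y + sA x y + dA x y) z = sA x (sA y z))
    (hAT4 : ∀ x y z : A, dA (sA x y) z = sA x (dA y z))
    (hAT5 : ∀ x y z : A, dA (pA x y) z = dA x (sA y z))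
    (hAT6 : ∀ x y z : A, pA (dA x y) z = dA x (pA y z))
    (hAT7 : ∀ x y z : A, dA (dA x y) z = dA x (dA y z))
    (hBT1 : ∀ x y z : B, pB (pB x y) z = pB x (pB y z + sB y z + dB y z))
    (hBT2 : ∀ x y z : B, pB (sB x y) z = sB x (pB y z))
    (hBT3 : ∀ x y z : B, sB (pB x y + sB x y + dB x y) z = sB x (sB y z))
    (hBT4 : ∀ x y z : B, dB (sB x y) z = sB x (dB y z))
    (hBT5 : ∀ x y z : B, dB (pB x y) z = dB x (sB y z))
    (hBT6 : ∀ x y z : B, pB (dB x y) z = dB x (pB y z))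
    (hBT7 : ∀ x y z : B, dB (dB x y) z = dB x (dB y z))
    (hpAA : ∀ a a' : A, pM (a, 0, 0) (a', 0, 0) = (pA a a', 0, 0))
    (hpBB : ∀ b b' : B, pM (0, b, 0) (0, b', 0) = (0, pB b b', 0))
    (hpAB : ∀ (a : A) (b' : B), pM (a, 0, 0) (0, b', 0) = 0)
    (hpBA : ∀ (b : B) (a' : A), pM (0, b, 0) (a', 0, 0) = (0, 0, a' ⊗ₜ[K] b))
    (hpAT : ∀ (a a' : A) (b' : B), pM (a, 0, 0) (0, 0, a' ⊗ₜ[K] b') = 0)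
    (hpTA : ∀ (a a' : A) (b : B), pM (0, 0, a ⊗ₜ[K] b) (a', 0, 0) = (0, 0, (pA a a' + sA a a' + dA a a') ⊗ₜ[K] b))
    (hpBT : ∀ (a' : A) (b b' : B), pM (0, b, 0) (0, 0, a' ⊗ₜ[K] b') = (0, 0, a' ⊗ₜ[K] (pB b b')))
    (hpTB : ∀ (a : A) (b b' : B), pM (0, 0, a ⊗ₜ[K] b) (0, b', 0) = (0, 0, a ⊗ₜ[K] (pB b b')))
    (hpTT : ∀ (a a' : A) (b b' : B), pM (0, 0, a ⊗ₜ[K] b) (0, 0, a' ⊗ₜ[K] b') = (0, 0, (pA a a' + sA a a' + dA a a') ⊗ₜ[K] (pB b b')))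
    (hsAA : ∀ a a' : A, sM (a, 0, 0) (a', 0, 0) = (sA a a', 0, 0))
    (hsBB : ∀ b b' : B, sM (0, b, 0) (0, b', 0) = (0, sB b b', 0))
    (hsAB : ∀ (a : A) (b' : B), sM (a, 0, 0) (0, b', 0) = (0, 0, a ⊗ₜ[K] b'))
    (hsBA : ∀ (b : B) (a' : A), sM (0, b, 0) (a', 0, 0) = 0)
    (hsAT : ∀ (a a' : A) (b' : B), sM (a, 0, 0) (0, 0, a' ⊗ₜ[K] b') = (0, 0, (pA a a' + sA a a' + dA a a') ⊗ₜ[K] b'))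
    (hsTA : ∀ (a a' : A) (b : B), sM (0, 0, a ⊗ₜ[K] b) (a', 0, 0) = 0)
    (hsBT : ∀ (a' : A) (b b' : B), sM (0, b, 0) (0, 0, a' ⊗ₜ[K] b') = (0, 0, a' ⊗ₜ[K] (sB b b')))
    (hsTB : ∀ (a : A) (b b' : B), sM (0, 0, a ⊗ₜ[K] b) (0, b', 0) = (0, 0, a ⊗ₜ[K] (sB b b')))
    (hsTT : ∀ (a a' : A) (b b' : B), sM (0, 0, a ⊗ₜ[K] b) (0, 0, a' ⊗ₜ[K] b') = (0, 0, (pA a a' + sA a a' + dA a a') ⊗ₜ[K] (sB b b')))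
    (hdAA : ∀ a a' : A, dM (a, 0, 0) (a', 0, 0) = (dA a a', 0, 0))
    (hdBB : ∀ b b' : B, dM (0, b, 0) (0, b', 0) = (0, dB b b', 0))
    (hdAB : ∀ (a : A) (b' : B), dM (a, 0, 0) (0, b', 0) = 0)
    (hdBA : ∀ (b : B) (a' : A), dM (0, b, 0) (a', 0, 0) = 0)
    (hdAT : ∀ (a a' : A) (b' : B), dM (a, 0, 0) (0, 0, a' ⊗ₜ[K] b') = 0)
    (hdTA : ∀ (a a' : A) (b : B), dM (0, 0, a ⊗ₜ[K] b) (a', 0, 0) = 0)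
    (hdBT : ∀ (a' : A) (b b' : B), dM (0, b, 0) (0, 0, a' ⊗ₜ[K] b') = (0, 0, a' ⊗ₜ[K] (dB b b')))
    (hdTB : ∀ (a : A) (b b' : B), dM (0, 0, a ⊗ₜ[K] b) (0, b', 0) = (0, 0, a ⊗ₜ[K] (dB b b')))
    (hdTT : ∀ (a a' : A) (b b' : B), dM (0, 0, a ⊗ₜ[K] b) (0, 0, a' ⊗ₜ[K] b') = (0, 0, (pA a a' + sA a a' + dA a a') ⊗ₜ[K] (dB b b'))) :
    (∀ x y z : (A × B × (A ⊗[K] B)), pM (pM x y) z = pM x (pM y z + sM y z + dM y z)) ∧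
    (∀ x y z : (A × B × (A ⊗[K] B)), pM (sM x y) z = sM x (pM y z)) ∧
    (∀ x y z : (A × B × (A ⊗[K] B)), sM (pM x y + sM x y + dM x y) z = sM x (sM y z)) ∧
    (∀ x y z : (A × B × (A ⊗[K] B)), dM (sM x y) z = sM x (dM y z)) ∧
    (∀ x y z : (A × B × (A ⊗[K] B)), dM (pM x y) z = dM x (sM y z)) ∧
    (∀ x y z : (A × B × (A ⊗[K] B)), pM (dM x y) z = dM x (pM y z)) ∧
    (∀ x y z : (A × B × (A ⊗[K] B)), dM (dM x y) z = dM x (dM y z)) := by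
  obtain ⟨tA, htA⟩ : ∃ t : A →ₗ[K] A →ₗ[K] A, ∀ x y, pA x y + sA x y + dA x y = t x y :=
    ⟨pA + sA + dA, fun _ _ => rfl⟩
  obtain ⟨tB, htB⟩ : ∃ t : B →ₗ[K] B →ₗ[K] B, ∀ x y, pB x y + sB x y + dB x y = t x y :=
    ⟨pB + sB + dB, fun _ _ => rfl⟩
  obtain ⟨tM, htM⟩ : ∃ t : (A × B × (A ⊗[K] B)) →ₗ[K] (A × B × (A ⊗[K] B)) →ₗ[K]
      (A × B × (A ⊗[K] B)), ∀ x y, pM x y + sM x y + dM x y = t x y :=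
    ⟨pM + sM + dM, fun _ _ => rfl⟩
  simp only [htA] at hAT1 hAT3 hpTA hpTT hsAT hsTT hdTT
  simp only [htB] at hBT1 hBT3
  simp only [htM]
  have tA_assoc := tridendriform_star_assoc htA hAT1 hAT2 hAT3 hAT4 hAT5 hAT6 hAT7
  have htAA : ∀ a a' : A, tM (a, 0, 0) (a', 0, 0) = (tA a a', 0, 0) := by
    intro a a'; simp [← htM, ← htA, hpAA, hsAA, hdAA]
  have htBB : ∀ b b' : B, tM (0, b, 0) (0, b', 0) = (0, tB b b', 0) := by
    intro b b'; simp [← htM, ← htB, hpBB, hsBB, hdBB]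
  have htAB : ∀ (a : A) (b' : B), tM (a, 0, 0) (0, b', 0) = (0, 0, a ⊗ₜ[K] b') := by
    intro a b'; simp [← htM, hpAB, hsAB, hdAB]
  have htBA : ∀ (b : B) (a' : A), tM (0, b, 0) (a', 0, 0) = (0, 0, a' ⊗ₜ[K] b) := by
    intro b a'; simp [← htM, hpBA, hsBA, hdBA]
  have htAT : ∀ (a a' : A) (b' : B),
      tM (a, 0, 0) (0, 0, a' ⊗ₜ[K] b') = (0, 0, tA a a' ⊗ₜ[K] b') := by
    intro a a' b'; simp [← htM, hpAT, hsAT, hdAT]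
  have htTA : ∀ (a a' : A) (b : B),
      tM (0, 0, a ⊗ₜ[K] b) (a', 0, 0) = (0, 0, tA a a' ⊗ₜ[K] b) := by
    intro a a' b; simp [← htM, hpTA, hsTA, hdTA]
  have htBT : ∀ (a' : A) (b b' : B),
      tM (0, b, 0) (0, 0, a' ⊗ₜ[K] b') = (0, 0, a' ⊗ₜ[K] tB b b') := by
    intro a' b b'; simp [← htM, ← htB, hpBT, hsBT, hdBT, tmul_add]
  have htTB : ∀ (a : A) (b b' : B),
      tM (0, 0, a ⊗ₜ[K] b) (0, b', 0) = (0, 0, a ⊗ₜ[K] tB b b') := by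
    intro a b b'; simp [← htM, ← htB, hpTB, hsTB, hdTB, tmul_add]
  have htTT : ∀ (a a' : A) (b b' : B),
      tM (0, 0, a ⊗ₜ[K] b) (0, 0, a' ⊗ₜ[K] b') = (0, 0, tA a a' ⊗ₜ[K] tB b b') := by
    intro a a' b b'; simp [← htM, ← htB, hpTT, hsTT, hdTT, tmul_add]
  let S : Set (A × B × (A ⊗[K] B)) :=
    {x | (∃ a, x = (a, 0, 0)) ∨ (∃ b, x = (0, b, 0)) ∨ ∃ a b, x = (0, 0, a ⊗ₜ[K] b)}
  have hSA : ∀ a : A, (a, 0, 0) ∈ S := fun a => Or.inl ⟨a, rfl⟩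
  have hSB : ∀ b : B, (0, b, 0) ∈ S := fun b => Or.inr (Or.inl ⟨b, rfl⟩)
  have hST : ∀ (a : A) (b : B), (0, 0, a ⊗ₜ[K] b) ∈ S := fun a b => Or.inr (Or.inr ⟨a, b, rfl⟩)
  refine ⟨?_, ?_, ?_, ?_, ?_, ?_, ?_⟩ <;>
  · refine bilin_comp_eq_of_generators hSA hSB hST ?_
    rintro _ (⟨a, rfl⟩ | ⟨b, rfl⟩ | ⟨a, b, rfl⟩) _ (⟨a', rfl⟩ | ⟨b', rfl⟩ | ⟨a', b', rfl⟩)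
      _ (⟨a'', rfl⟩ | ⟨b'', rfl⟩ | ⟨a'', b'', rfl⟩) <;>
    simp only [map_zero, LinearMap.zero_apply, tA_assoc,
      hAT1, hAT2, hAT3, hAT4, hAT5, hAT6, hAT7, hBT1, hBT2, hBT3, hBT4, hBT5, hBT6, hBT7,
      hpAA, hpBB, hpAB, hpBA, hpAT, hpTA, hpBT, hpTB, hpTT,
      hsAA, hsBB, hsAB, hsBA, hsAT, hsTA, hsBT, hsTB, hsTT,
      hdAA, hdBB, hdAB, hdBA, hdAT, hdTA, hdBT, hdTB, hdTT,
      htAA, htBB, htAB, htBA, htAT, htTA, htBT, htTB, htTT]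
end

section
/- Let K be a field and let A, B be pre-dendriform algebras over K. Define on M := A ⊕ B ⊕ (A ⊗_K B) the bilinear operations determined, for a, a' ∈ A and b, b' ∈ B and for ∘ ∈ {≺, ≻, *}, by: a∘a' and b∘b' as in A, resp. B; a≺b' := 0, a≻b' := a⊗b', a*b' := a⊗b'; b≺a' := a'⊗b, b≻a' := 0, b*a' := a'⊗b; a≺(a'⊗b') := 0, a≻(a'⊗b') := (a*a')⊗b', a*(a'⊗b') := (a*a')⊗b'; (a⊗b)≺a' := (a*a')⊗b, (a⊗b)≻a' := 0, (a⊗b)*a' := (a*a')⊗b; b∘(a'⊗b') := a'⊗(b∘b'); (a⊗b)∘b' := a⊗(b∘b'); (a⊗b)∘(a'⊗b') := (a*a')⊗(b∘b'). Then M with these three operations is a pre-dendriform algebra (satisfies (R0), (R1), (R2), (R3)). -/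
open TensorProduct

/-- The generators of `A ⊕ B ⊕ (A ⊗ B)`: elements of `A`, elements of `B`, and pure tensors. -/
def prodTensorGenerators (K A B : Type*) [CommRing K] [AddCommGroup A] [Module K A]
    [AddCommGroup B] [Module K B] : Set (A × B × (A ⊗[K] B)) :=
  {x | (∃ a, x = (a, 0, 0)) ∨ (∃ b, x = (0, b, 0)) ∨ ∃ a b, x = (0, 0, a ⊗ₜ[K] b)}

/-- An additive property of elements of `A ⊕ B ⊕ (A ⊗ B)` may be checked on generators. -/
theorem prodTensorGenerators_induction {K A B : Type*} [CommRing K] [AddCommGroup A] [Module K A]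
    [AddCommGroup B] [Module K B] {P : A × B × (A ⊗[K] B) → Prop}
    (hgen : ∀ x ∈ prodTensorGenerators K A B, P x)
    (hadd : ∀ x y, P x → P y → P (x + y)) (x : A × B × (A ⊗[K] B)) : P x := by
  obtain ⟨a, b, t⟩ := x
  have ha : P (a, 0, 0) := hgen _ (.inl ⟨a, rfl⟩)
  have hb : P (0, b, 0) := hgen _ (.inr (.inl ⟨b, rfl⟩))
  have ht : P (0, 0, t) := by
    induction t using TensorProduct.induction_on with
    | zero => exact hgen _ (.inl ⟨0, rfl⟩)
    | tmul a b => exact hgen _ (.inr (.inr ⟨a, b, rfl⟩))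
    | add t u ht hu => simpa using hadd _ _ ht hu
  simpa using hadd _ _ (hadd _ _ ha hb) ht

/-- An associativity-type identity between bilinear operations on `A ⊕ B ⊕ (A ⊗ B)` may be
checked on generators. -/
theorem bilin_assoc_of_generators {K A B : Type*} [CommRing K] [AddCommGroup A] [Module K A]
    [AddCommGroup B] [Module K B]
    (f g h k : (A × B × (A ⊗[K] B)) →ₗ[K] (A × B × (A ⊗[K] B)) →ₗ[K] (A × B × (A ⊗[K] B)))
    (hgen : ∀ x ∈ prodTensorGenerators K A B, ∀ y ∈ prodTensorGenerators K A B,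
      ∀ z ∈ prodTensorGenerators K A B, f (g x y) z = h x (k y z))
    (x y z : A × B × (A ⊗[K] B)) : f (g x y) z = h x (k y z) := by
  refine prodTensorGenerators_induction (P := fun x => ∀ y z, f (g x y) z = h x (k y z))
    (fun x hx => ?_) (fun u v hu hv y z => by simp [hu, hv]) x y z
  refine prodTensorGenerators_induction (P := fun y => ∀ z, f (g x y) z = h x (k y z))
    (fun y hy => ?_) (fun u v hu hv z => by simp [hu, hv])
  exact prodTensorGenerators_induction (hgen x hx y hy) (fun u v hu hv => by simp [hu, hv])

/-- Coherence for pre-dendriform algebras: if `A` and `B` are pre-dendriform algebras, then `M = A ⊕ B ⊕ (A ⊗ B)` with the operations induced by the unit action `1 ≺ x = 0, 1 ≻ x = x, x ≺ 1 = x, x ≻ 1 = 0, 1 * x = x = x * 1` is a pre-dendriform algebra. -/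
theorem coherence_predendriform
    (K : Type*) [Field K]
    (A : Type*) [AddCommGroup A] [Module K A]
    (B : Type*) [AddCommGroup B] [Module K B]
    (pA sA mA : A →ₗ[K] A →ₗ[K] A)
    (pB sB mB : B →ₗ[K] B →ₗ[K] B)
    (pM sM mM : (A × B × (A ⊗[K] B)) →ₗ[K] (A × B × (A ⊗[K] B)) →ₗ[K] (A × B × (A ⊗[K] B)))
    (hAR0 : ∀ x y z : A, mA (mA x y) z = mA x (mA y z))
    (hAR1 : ∀ x y z : A, pA (pA x y) z = pA x (mA y z))
    (hAR2 : ∀ x y z : A, pA (sA x y) z = sA x (pA y z))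
    (hAR3 : ∀ x y z : A, sA (mA x y) z = sA x (sA y z))
    (hBR0 : ∀ x y z : B, mB (mB x y) z = mB x (mB y z))
    (hBR1 : ∀ x y z : B, pB (pB x y) z = pB x (mB y z))
    (hBR2 : ∀ x y z : B, pB (sB x y) z = sB x (pB y z))
    (hBR3 : ∀ x y z : B, sB (mB x y) z = sB x (sB y z))
    (hpAA : ∀ a a' : A, pM (a, 0, 0) (a', 0, 0) = (pA a a', 0, 0))
    (hpBB : ∀ b b' : B, pM (0, b, 0) (0, b', 0) = (0, pB b b', 0))
    (hpAB : ∀ (a : A) (b' : B), pM (a, 0, 0) (0, b', 0) = 0)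
    (hpBA : ∀ (b : B) (a' : A), pM (0, b, 0) (a', 0, 0) = (0, 0, a' ⊗ₜ[K] b))
    (hpAT : ∀ (a a' : A) (b' : B), pM (a, 0, 0) (0, 0, a' ⊗ₜ[K] b') = 0)
    (hpTA : ∀ (a a' : A) (b : B), pM (0, 0, a ⊗ₜ[K] b) (a', 0, 0) = (0, 0, (mA a a') ⊗ₜ[K] b))
    (hpBT : ∀ (a' : A) (b b' : B), pM (0, b, 0) (0, 0, a' ⊗ₜ[K] b') = (0, 0, a' ⊗ₜ[K] (pB b b')))
    (hpTB : ∀ (a : A) (b b' : B), pM (0, 0, a ⊗ₜ[K] b) (0, b', 0) = (0, 0, a ⊗ₜ[K] (pB b b')))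
    (hpTT : ∀ (a a' : A) (b b' : B), pM (0, 0, a ⊗ₜ[K] b) (0, 0, a' ⊗ₜ[K] b') = (0, 0, (mA a a') ⊗ₜ[K] (pB b b')))
    (hsAA : ∀ a a' : A, sM (a, 0, 0) (a', 0, 0) = (sA a a', 0, 0))
    (hsBB : ∀ b b' : B, sM (0, b, 0) (0, b', 0) = (0, sB b b', 0))
    (hsAB : ∀ (a : A) (b' : B), sM (a, 0, 0) (0, b', 0) = (0, 0, a ⊗ₜ[K] b'))
    (hsBA : ∀ (b : B) (a' : A), sM (0, b, 0) (a', 0, 0) = 0)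
    (hsAT : ∀ (a a' : A) (b' : B), sM (a, 0, 0) (0, 0, a' ⊗ₜ[K] b') = (0, 0, (mA a a') ⊗ₜ[K] b'))
    (hsTA : ∀ (a a' : A) (b : B), sM (0, 0, a ⊗ₜ[K] b) (a', 0, 0) = 0)
    (hsBT : ∀ (a' : A) (b b' : B), sM (0, b, 0) (0, 0, a' ⊗ₜ[K] b') = (0, 0, a' ⊗ₜ[K] (sB b b')))
    (hsTB : ∀ (a : A) (b b' : B), sM (0, 0, a ⊗ₜ[K] b) (0, b', 0) = (0, 0, a ⊗ₜ[K] (sB b b')))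
    (hsTT : ∀ (a a' : A) (b b' : B), sM (0, 0, a ⊗ₜ[K] b) (0, 0, a' ⊗ₜ[K] b') = (0, 0, (mA a a') ⊗ₜ[K] (sB b b')))
    (hmAA : ∀ a a' : A, mM (a, 0, 0) (a', 0, 0) = (mA a a', 0, 0))
    (hmBB : ∀ b b' : B, mM (0, b, 0) (0, b', 0) = (0, mB b b', 0))
    (hmAB : ∀ (a : A) (b' : B), mM (a, 0, 0) (0, b', 0) = (0, 0, a ⊗ₜ[K] b'))
    (hmBA : ∀ (b : B) (a' : A), mM (0, b, 0) (a', 0, 0) = (0, 0, a' ⊗ₜ[K] b))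
    (hmAT : ∀ (a a' : A) (b' : B), mM (a, 0, 0) (0, 0, a' ⊗ₜ[K] b') = (0, 0, (mA a a') ⊗ₜ[K] b'))
    (hmTA : ∀ (a a' : A) (b : B), mM (0, 0, a ⊗ₜ[K] b) (a', 0, 0) = (0, 0, (mA a a') ⊗ₜ[K] b))
    (hmBT : ∀ (a' : A) (b b' : B), mM (0, b, 0) (0, 0, a' ⊗ₜ[K] b') = (0, 0, a' ⊗ₜ[K] (mB b b')))
    (hmTB : ∀ (a : A) (b b' : B), mM (0, 0, a ⊗ₜ[K] b) (0, b', 0) = (0, 0, a ⊗ₜ[K] (mB b b')))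
    (hmTT : ∀ (a a' : A) (b b' : B), mM (0, 0, a ⊗ₜ[K] b) (0, 0, a' ⊗ₜ[K] b') = (0, 0, (mA a a') ⊗ₜ[K] (mB b b'))) :
    (∀ x y z : (A × B × (A ⊗[K] B)), mM (mM x y) z = mM x (mM y z)) ∧
    (∀ x y z : (A × B × (A ⊗[K] B)), pM (pM x y) z = pM x (mM y z)) ∧
    (∀ x y z : (A × B × (A ⊗[K] B)), pM (sM x y) z = sM x (pM y z)) ∧
    (∀ x y z : (A × B × (A ⊗[K] B)), sM (mM x y) z = sM x (sM y z)) := by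
  refine ⟨?_, ?_, ?_, ?_⟩ <;>
  · refine bilin_assoc_of_generators _ _ _ _ ?_
    rintro _ (⟨a, rfl⟩ | ⟨b, rfl⟩ | ⟨a, b, rfl⟩) _ (⟨a', rfl⟩ | ⟨b', rfl⟩ | ⟨a', b', rfl⟩)
      _ (⟨a'', rfl⟩ | ⟨b'', rfl⟩ | ⟨a'', b'', rfl⟩) <;>
    simp only [hpAA, hpBB, hpAB, hpBA, hpAT, hpTA, hpBT, hpTB, hpTT,
      hsAA, hsBB, hsAB, hsBA, hsAT, hsTA, hsBT, hsTB, hsTT,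
      hmAA, hmBB, hmAB, hmBA, hmAT, hmTA, hmBT, hmTB, hmTT,
      hAR0, hAR1, hAR2, hAR3, hBR0, hBR1, hBR2, hBR3,
      map_zero, LinearMap.zero_apply]
end

section
/- Let K be a field and let A, B be quadri-algebras over K. Define on M := A ⊕ B ⊕ (A ⊗_K B) the bilinear operations determined, for a, a' ∈ A and b, b' ∈ B and for ∘ ∈ {↖, ↗, ↙, ↘}, by: a∘a' and b∘b' as in A, resp. B; a↘b' := a⊗b' and a∘b' := 0 for ∘ ≠ ↘; b↖a' := a'⊗b and b∘a' := 0 for ∘ ≠ ↖; a↘(a'⊗b') := (a*a')⊗b' and a∘(a'⊗b') := 0 for ∘ ≠ ↘; (a⊗b)↖a' := (a*a')⊗b and (a⊗b)∘a' := 0 for ∘ ≠ ↖; b∘(a'⊗b') := a'⊗(b∘b'); (a⊗b)∘b' := a⊗(b∘b'); (a⊗b)∘(a'⊗b') := (a*a')⊗(b∘b'). Then M with these four operations is a quadri-algebra (satisfies the nine relations (Q1)–(Q9)). -/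
open TensorProduct

/-- Two trilinear expressions of the form `g (f x y) z` and `h x (k y z)` agree everywhere as soon as
they agree on a spanning set. -/
theorem LinearMap.comp_eq_comp_of_span_eq_top {K M : Type*} [CommSemiring K] [AddCommMonoid M]
    [Module K M] {S : Set M} (hS : Submodule.span K S = ⊤) (f g h k : M →ₗ[K] M →ₗ[K] M)
    (H : ∀ x ∈ S, ∀ y ∈ S, ∀ z ∈ S, g (f x y) z = h x (k y z)) (x y z : M) :
    g (f x y) z = h x (k y z) := by
  have hxy : ∀ x ∈ S, ∀ y ∈ S, g (f x y) = h x ∘ₗ k y := fun x hx y hy =>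
    LinearMap.ext_on hS fun z hz => H x hx y hy z hz
  have hx : ∀ x ∈ S, g ∘ₗ f x = (LinearMap.llcomp K M M M (h x)) ∘ₗ k := fun x hx =>
    LinearMap.ext_on hS fun y hy => hxy x hx y hy
  have hf : (LinearMap.llcomp K M M (M →ₗ[K] M) g) ∘ₗ f =
      (LinearMap.lcomp K (M →ₗ[K] M) k) ∘ₗ (LinearMap.llcomp K M M M) ∘ₗ h :=
    LinearMap.ext_on hS hx
  exact LinearMap.congr_fun (LinearMap.congr_fun (LinearMap.congr_fun hf x) y) z

/-- `A × B × (A ⊗ B)` is spanned by the elements of `A`, those of `B` and the pure tensors. -/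
theorem span_prod_prod_tmul_eq_top (K A B : Type*) [CommSemiring K] [AddCommMonoid A] [Module K A]
    [AddCommMonoid B] [Module K B] :
    Submodule.span K ({m : A × B × (A ⊗[K] B) | (∃ a, m = (a, 0, 0)) ∨ (∃ b, m = (0, b, 0)) ∨
      ∃ a b, m = (0, 0, a ⊗ₜ[K] b)}) = ⊤ := by
  rw [eq_top_iff]
  rintro ⟨a, b, t⟩ -
  have ht : ((0, 0, t) : A × B × (A ⊗[K] B)) ∈ Submodule.span K
      ({m : A × B × (A ⊗[K] B) | (∃ a, m = (a, 0, 0)) ∨ (∃ b, m = (0, b, 0)) ∨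
        ∃ a b, m = (0, 0, a ⊗ₜ[K] b)}) := by
    induction t with
    | zero => exact Submodule.zero_mem _
    | tmul a b => exact Submodule.subset_span (.inr (.inr ⟨a, b, rfl⟩))
    | add u v hu hv => simpa using Submodule.add_mem _ hu hv
  simpa using Submodule.add_mem _ (Submodule.add_mem _
    (Submodule.subset_span (.inl ⟨a, rfl⟩)) (Submodule.subset_span (.inr (.inl ⟨b, rfl⟩)))) ht

set_option maxHeartbeats 4000000 in
/-- Coherence for quadri-algebras: if `A` and `B` are quadri-algebras, then `M = A ⊕ B ⊕ (A ⊗ B)` with the operations induced by the unit action `a ↖ 1 = a, 1 ↘ a = a` (all other products with `1` zero) is a quadri-algebra. -/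
theorem coherence_quadri
    (K : Type*) [Field K]
    (A : Type*) [AddCommGroup A] [Module K A]
    (B : Type*) [AddCommGroup B] [Module K B]
    (nwA neA swA seA : A →ₗ[K] A →ₗ[K] A)
    (nwB neB swB seB : B →ₗ[K] B →ₗ[K] B)
    (nwM neM swM seM : (A × B × (A ⊗[K] B)) →ₗ[K] (A × B × (A ⊗[K] B)) →ₗ[K] (A × B × (A ⊗[K] B)))
    (hAQ1 : ∀ x y z : A, nwA (nwA x y) z = nwA x (seA y z + neA y z + nwA y z + swA y z))
    (hAQ2 : ∀ x y z : A, nwA (neA x y) z = neA x (nwA y z + swA y z))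
    (hAQ3 : ∀ x y z : A, neA (neA x y + nwA x y) z = neA x (neA y z + seA y z))
    (hAQ4 : ∀ x y z : A, nwA (swA x y) z = swA x (neA y z + nwA y z))
    (hAQ5 : ∀ x y z : A, nwA (seA x y) z = seA x (nwA y z))
    (hAQ6 : ∀ x y z : A, neA (seA x y + swA x y) z = seA x (neA y z))
    (hAQ7 : ∀ x y z : A, swA (nwA x y + swA x y) z = swA x (seA y z + swA y z))
    (hAQ8 : ∀ x y z : A, swA (neA x y + seA x y) z = seA x (swA y z))
    (hAQ9 : ∀ x y z : A, seA (seA x y + neA x y + nwA x y + swA x y) z = seA x (seA y z))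
    (hBQ1 : ∀ x y z : B, nwB (nwB x y) z = nwB x (seB y z + neB y z + nwB y z + swB y z))
    (hBQ2 : ∀ x y z : B, nwB (neB x y) z = neB x (nwB y z + swB y z))
    (hBQ3 : ∀ x y z : B, neB (neB x y + nwB x y) z = neB x (neB y z + seB y z))
    (hBQ4 : ∀ x y z : B, nwB (swB x y) z = swB x (neB y z + nwB y z))
    (hBQ5 : ∀ x y z : B, nwB (seB x y) z = seB x (nwB y z))
    (hBQ6 : ∀ x y z : B, neB (seB x y + swB x y) z = seB x (neB y z))
    (hBQ7 : ∀ x y z : B, swB (nwB x y + swB x y) z = swB x (seB y z + swB y z))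
    (hBQ8 : ∀ x y z : B, swB (neB x y + seB x y) z = seB x (swB y z))
    (hBQ9 : ∀ x y z : B, seB (seB x y + neB x y + nwB x y + swB x y) z = seB x (seB y z))
    (hnwAA : ∀ a a' : A, nwM (a, 0, 0) (a', 0, 0) = (nwA a a', 0, 0))
    (hnwBB : ∀ b b' : B, nwM (0, b, 0) (0, b', 0) = (0, nwB b b', 0))
    (hnwAB : ∀ (a : A) (b' : B), nwM (a, 0, 0) (0, b', 0) = 0)
    (hnwBA : ∀ (b : B) (a' : A), nwM (0, b, 0) (a', 0, 0) = (0, 0, a' ⊗ₜ[K] b))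
    (hnwAT : ∀ (a a' : A) (b' : B), nwM (a, 0, 0) (0, 0, a' ⊗ₜ[K] b') = 0)
    (hnwTA : ∀ (a a' : A) (b : B), nwM (0, 0, a ⊗ₜ[K] b) (a', 0, 0) = (0, 0, (seA a a' + neA a a' + nwA a a' + swA a a') ⊗ₜ[K] b))
    (hnwBT : ∀ (a' : A) (b b' : B), nwM (0, b, 0) (0, 0, a' ⊗ₜ[K] b') = (0, 0, a' ⊗ₜ[K] (nwB b b')))
    (hnwTB : ∀ (a : A) (b b' : B), nwM (0, 0, a ⊗ₜ[K] b) (0, b', 0) = (0, 0, a ⊗ₜ[K] (nwB b b')))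
    (hnwTT : ∀ (a a' : A) (b b' : B), nwM (0, 0, a ⊗ₜ[K] b) (0, 0, a' ⊗ₜ[K] b') = (0, 0, (seA a a' + neA a a' + nwA a a' + swA a a') ⊗ₜ[K] (nwB b b')))
    (hneAA : ∀ a a' : A, neM (a, 0, 0) (a', 0, 0) = (neA a a', 0, 0))
    (hneBB : ∀ b b' : B, neM (0, b, 0) (0, b', 0) = (0, neB b b', 0))
    (hneAB : ∀ (a : A) (b' : B), neM (a, 0, 0) (0, b', 0) = 0)
    (hneBA : ∀ (b : B) (a' : A), neM (0, b, 0) (a', 0, 0) = 0)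
    (hneAT : ∀ (a a' : A) (b' : B), neM (a, 0, 0) (0, 0, a' ⊗ₜ[K] b') = 0)
    (hneTA : ∀ (a a' : A) (b : B), neM (0, 0, a ⊗ₜ[K] b) (a', 0, 0) = 0)
    (hneBT : ∀ (a' : A) (b b' : B), neM (0, b, 0) (0, 0, a' ⊗ₜ[K] b') = (0, 0, a' ⊗ₜ[K] (neB b b')))
    (hneTB : ∀ (a : A) (b b' : B), neM (0, 0, a ⊗ₜ[K] b) (0, b', 0) = (0, 0, a ⊗ₜ[K] (neB b b')))
    (hneTT : ∀ (a a' : A) (b b' : B), neM (0, 0, a ⊗ₜ[K] b) (0, 0, a' ⊗ₜ[K] b') = (0, 0, (seA a a' + neA a a' + nwA a a' + swA a a') ⊗ₜ[K] (neB b b')))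
    (hswAA : ∀ a a' : A, swM (a, 0, 0) (a', 0, 0) = (swA a a', 0, 0))
    (hswBB : ∀ b b' : B, swM (0, b, 0) (0, b', 0) = (0, swB b b', 0))
    (hswAB : ∀ (a : A) (b' : B), swM (a, 0, 0) (0, b', 0) = 0)
    (hswBA : ∀ (b : B) (a' : A), swM (0, b, 0) (a', 0, 0) = 0)
    (hswAT : ∀ (a a' : A) (b' : B), swM (a, 0, 0) (0, 0, a' ⊗ₜ[K] b') = 0)
    (hswTA : ∀ (a a' : A) (b : B), swM (0, 0, a ⊗ₜ[K] b) (a', 0, 0) = 0)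
    (hswBT : ∀ (a' : A) (b b' : B), swM (0, b, 0) (0, 0, a' ⊗ₜ[K] b') = (0, 0, a' ⊗ₜ[K] (swB b b')))
    (hswTB : ∀ (a : A) (b b' : B), swM (0, 0, a ⊗ₜ[K] b) (0, b', 0) = (0, 0, a ⊗ₜ[K] (swB b b')))
    (hswTT : ∀ (a a' : A) (b b' : B), swM (0, 0, a ⊗ₜ[K] b) (0, 0, a' ⊗ₜ[K] b') = (0, 0, (seA a a' + neA a a' + nwA a a' + swA a a') ⊗ₜ[K] (swB b b')))
    (hseAA : ∀ a a' : A, seM (a, 0, 0) (a', 0, 0) = (seA a a', 0, 0))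
    (hseBB : ∀ b b' : B, seM (0, b, 0) (0, b', 0) = (0, seB b b', 0))
    (hseAB : ∀ (a : A) (b' : B), seM (a, 0, 0) (0, b', 0) = (0, 0, a ⊗ₜ[K] b'))
    (hseBA : ∀ (b : B) (a' : A), seM (0, b, 0) (a', 0, 0) = 0)
    (hseAT : ∀ (a a' : A) (b' : B), seM (a, 0, 0) (0, 0, a' ⊗ₜ[K] b') = (0, 0, (seA a a' + neA a a' + nwA a a' + swA a a') ⊗ₜ[K] b'))
    (hseTA : ∀ (a a' : A) (b : B), seM (0, 0, a ⊗ₜ[K] b) (a', 0, 0) = 0)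
    (hseBT : ∀ (a' : A) (b b' : B), seM (0, b, 0) (0, 0, a' ⊗ₜ[K] b') = (0, 0, a' ⊗ₜ[K] (seB b b')))
    (hseTB : ∀ (a : A) (b b' : B), seM (0, 0, a ⊗ₜ[K] b) (0, b', 0) = (0, 0, a ⊗ₜ[K] (seB b b')))
    (hseTT : ∀ (a a' : A) (b b' : B), seM (0, 0, a ⊗ₜ[K] b) (0, 0, a' ⊗ₜ[K] b') = (0, 0, (seA a a' + neA a a' + nwA a a' + swA a a') ⊗ₜ[K] (seB b b'))) :
    (∀ x y z : (A × B × (A ⊗[K] B)), nwM (nwM x y) z = nwM x (seM y z + neM y z + nwM y z + swM y z)) ∧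
    (∀ x y z : (A × B × (A ⊗[K] B)), nwM (neM x y) z = neM x (nwM y z + swM y z)) ∧
    (∀ x y z : (A × B × (A ⊗[K] B)), neM (neM x y + nwM x y) z = neM x (neM y z + seM y z)) ∧
    (∀ x y z : (A × B × (A ⊗[K] B)), nwM (swM x y) z = swM x (neM y z + nwM y z)) ∧
    (∀ x y z : (A × B × (A ⊗[K] B)), nwM (seM x y) z = seM x (nwM y z)) ∧
    (∀ x y z : (A × B × (A ⊗[K] B)), neM (seM x y + swM x y) z = seM x (neM y z)) ∧
    (∀ x y z : (A × B × (A ⊗[K] B)), swM (nwM x y + swM x y) z = swM x (seM y z + swM y z)) ∧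
    (∀ x y z : (A × B × (A ⊗[K] B)), swM (neM x y + seM x y) z = seM x (swM y z)) ∧
    (∀ x y z : (A × B × (A ⊗[K] B)), seM (seM x y + neM x y + nwM x y + swM x y) z = seM x (seM y z)) := by
  obtain ⟨mulA, hmulA⟩ : ∃ m : A →ₗ[K] A →ₗ[K] A,
      ∀ a a', seA a a' + neA a a' + nwA a a' + swA a a' = m a a' :=
    ⟨seA + neA + nwA + swA, fun _ _ => rfl⟩
  have hmulA_assoc : ∀ x y z, mulA (mulA x y) z = mulA x (mulA y z) := by
    intro x y z
    have h1 := hAQ1 x y z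
    have h2 := hAQ2 x y z
    have h3 := hAQ3 x y z
    have h4 := hAQ4 x y z
    have h5 := hAQ5 x y z
    have h6 := hAQ6 x y z
    have h7 := hAQ7 x y z
    have h8 := hAQ8 x y z
    have h9 := hAQ9 x y z
    simp only [← hmulA, map_add, LinearMap.add_apply] at h1 h2 h3 h4 h5 h6 h7 h8 h9 ⊢
    linear_combination (norm := module) h1 + h2 + h3 + h4 + h5 + h6 + h7 + h8 + h9
  have key := LinearMap.comp_eq_comp_of_span_eq_top (span_prod_prod_tmul_eq_top K A B)
  simp only [hmulA] at hAQ1 hAQ9 hnwTA hnwTT hneTT hswTT hseAT hseTT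
  refine ⟨key nwM nwM nwM (seM + neM + nwM + swM) ?_, key neM nwM neM (nwM + swM) ?_,
    key (neM + nwM) neM neM (neM + seM) ?_, key swM nwM swM (neM + nwM) ?_,
    key seM nwM seM nwM ?_, key (seM + swM) neM seM neM ?_,
    key (nwM + swM) swM swM (seM + swM) ?_, key (neM + seM) swM seM swM ?_,
    key (seM + neM + nwM + swM) seM seM seM ?_⟩
  all_goals
    rintro _ (⟨a, rfl⟩ | ⟨b, rfl⟩ | ⟨a, b, rfl⟩) _ (⟨a', rfl⟩ | ⟨b', rfl⟩ | ⟨a', b', rfl⟩)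
      _ (⟨a'', rfl⟩ | ⟨b'', rfl⟩ | ⟨a'', b'', rfl⟩) <;>
    simp only [LinearMap.add_apply, LinearMap.zero_apply, map_zero, Prod.mk_add_mk, add_zero,
      zero_add, ← TensorProduct.tmul_add, hmulA, hmulA_assoc, hnwAA, hnwBB, hnwAB, hnwBA,
      hnwAT, hnwTA, hnwBT, hnwTB, hnwTT, hneAA, hneBB, hneAB, hneBA, hneAT, hneTA, hneBT, hneTB,
      hneTT, hswAA, hswBB, hswAB, hswBA, hswAT, hswTA, hswBT, hswTB, hswTT, hseAA, hseBB, hseAB,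
      hseBA, hseAT, hseTA, hseBT, hseTB, hseTT, hAQ1, hAQ2, hAQ3, hAQ4, hAQ5, hAQ6, hAQ7, hAQ8,
      hAQ9, hBQ1, hBQ2, hBQ3, hBQ4, hBQ5, hBQ6, hBQ7, hBQ8, hBQ9]
end

section
/- Let K be a field, V a K-vector space, Mag(V) the free magmatic K-algebra on V (the free non-unital, non-associative K-algebra on V), and H := K·1 ⊕ Mag(V) its unitization. Equip H ⊗_K H with the componentwise (non-associative, unital) product (u⊗v)(u'⊗v') := (uu')⊗(vv'), with unit 1⊗1. Then there exists a unique K-linear map Δ : H → H ⊗ H such that Δ(1) = 1⊗1, Δ(uv) = Δ(u)Δ(v) for all u, v ∈ H, and Δ(v) = v⊗1 + 1⊗v for all v ∈ V; moreover Δ is coassociative: (Δ ⊗ id) ∘ Δ = (id ⊗ Δ) ∘ Δ. -/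
universe u

open TensorProduct

section

variable (K M : Type*) [Field K] [NonUnitalNonAssocRing M] [Module K M]
    [SMulCommClass K M M] [IsScalarTower K M M]

instance unitization_smulCommClass :
    SMulCommClass K (Unitization K M) (Unitization K M) where
  smul_comm k x y := by
    ext
    · simp only [Unitization.fst_smul, Unitization.fst_mul, smul_eq_mul]
      ring
    · simp only [Unitization.snd_smul, Unitization.snd_mul, smul_add,
        Unitization.fst_smul, smul_eq_mul]
      rw [mul_smul, mul_smul_comm, smul_comm k x.fst]

instance unitization_isScalarTower :
    IsScalarTower K (Unitization K M) (Unitization K M) where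
  smul_assoc k x y := by
    ext
    · simp only [Unitization.fst_smul, Unitization.fst_mul, smul_eq_mul]
      ring
    · simp only [Unitization.snd_smul, Unitization.snd_mul, smul_add,
        Unitization.fst_smul, smul_eq_mul]
      rw [mul_smul, smul_mul_assoc, smul_comm y.fst k]

end

namespace Unitization

section

variable {K M B : Type*} [Field K] [NonUnitalNonAssocRing M] [Module K M]
    [NonAssocRing B] [Module K B]

theorem linearMap_apply_eq (f : Unitization K M →ₗ[K] B) (hf : f 1 = 1) (x : Unitization K M) :
    f x = x.fst • (1 : B) + f (inr x.snd) := by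
  have hx : x = x.fst • (1 : Unitization K M) + inr x.snd := by
    ext <;> simp
  conv_lhs => rw [hx]
  rw [map_add, map_smul, hf]

/-- The unital extension of a linear map to the unitization. -/
def extendUnital (F : M →ₗ[K] B) : Unitization K M →ₗ[K] B where
  toFun x := x.fst • (1 : B) + F x.snd
  map_add' x y := by
    simp only [fst_add, snd_add, add_smul, map_add]
    abel
  map_smul' k x := by
    simp only [fst_smul, snd_smul, smul_eq_mul, mul_smul, map_smul, smul_add, RingHom.id_apply]

theorem extendUnital_apply (F : M →ₗ[K] B) (x : Unitization K M) :
    extendUnital F x = x.fst • (1 : B) + F x.snd := rfl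

theorem extendUnital_one (F : M →ₗ[K] B) : extendUnital F 1 = 1 := by
  simp [extendUnital_apply]

theorem extendUnital_inr (F : M →ₗ[K] B) (m : M) : extendUnital F (inr m) = F m := by
  simp [extendUnital_apply]

theorem extendUnital_mul [SMulCommClass K B B] [IsScalarTower K B B] (F : M →ₗ[K] B)
    (hF : ∀ x y : M, F (x * y) = F x * F y) (x y : Unitization K M) :
    extendUnital F (x * y) = extendUnital F x * extendUnital F y := by
  simp only [extendUnital_apply, fst_mul, snd_mul, map_add, map_smul, hF, add_mul, mul_add,
    smul_mul_assoc, mul_smul_comm, one_mul, mul_one, mul_smul, smul_add]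
  rw [smul_comm y.fst x.fst (1 : B)]
  abel

end

end Unitization

section

variable {K A B C D : Type*} [Field K]
    [NonUnitalNonAssocRing A] [Module K A] [SMulCommClass K A A] [IsScalarTower K A A]
    [NonUnitalNonAssocRing B] [Module K B] [SMulCommClass K B B] [IsScalarTower K B B]
    [NonUnitalNonAssocRing C] [Module K C]

theorem LinearMap.map_mul_of_tmul (f : A ⊗[K] B →ₗ[K] C)
    (h : ∀ a a' b b', f ((a * a') ⊗ₜ[K] (b * b')) = f (a ⊗ₜ b) * f (a' ⊗ₜ b'))
    (x y : A ⊗[K] B) : f (x * y) = f x * f y := by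
  induction x with
  | zero => simp
  | add x₁ x₂ h₁ h₂ => simp only [add_mul, map_add, h₁, h₂]
  | tmul a b =>
    induction y with
    | zero => simp
    | add y₁ y₂ h₁ h₂ => simp only [mul_add, map_add, h₁, h₂]
    | tmul a' b' => rw [Algebra.TensorProduct.tmul_mul_tmul, h]

variable [SMulCommClass K C C] [IsScalarTower K C C]
    [NonUnitalNonAssocRing D] [Module K D] [SMulCommClass K D D] [IsScalarTower K D D]

theorem TensorProduct.map_map_mul (f : A →ₗ[K] C) (g : B →ₗ[K] D)
    (hf : ∀ x y, f (x * y) = f x * f y) (hg : ∀ x y, g (x * y) = g x * g y)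
    (x y : A ⊗[K] B) :
    TensorProduct.map f g (x * y) = TensorProduct.map f g x * TensorProduct.map f g y :=
  LinearMap.map_mul_of_tmul _ (fun a a' b b' => by
    simp only [TensorProduct.map_tmul, hf, hg, Algebra.TensorProduct.tmul_mul_tmul]) x y

theorem TensorProduct.assoc_map_mul (x y : (A ⊗[K] B) ⊗[K] C) :
    TensorProduct.assoc K A B C (x * y)
      = TensorProduct.assoc K A B C x * TensorProduct.assoc K A B C y := by
  refine LinearMap.map_mul_of_tmul (TensorProduct.assoc K A B C).toLinearMap ?_ x y
  intro p q c c'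
  simp only [LinearEquiv.coe_coe]
  induction p with
  | zero => simp
  | add p₁ p₂ h₁ h₂ => simp only [add_mul, add_tmul, map_add, h₁, h₂]
  | tmul a b =>
    induction q with
    | zero => simp
    | add q₁ q₂ h₁ h₂ => simp only [mul_add, add_tmul, map_add, h₁, h₂]
    | tmul a' b' => simp only [Algebra.TensorProduct.tmul_mul_tmul, TensorProduct.assoc_tmul]

end

/-- Unital multiplicative maps out of the unitization of a free magmatic algebra agree as soon
as they agree on the generators. -/
theorem Unitization.linearMap_ext_of_free {K : Type*} [Field K] {V : Type*} [AddCommGroup V]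
    [Module K V] {Mag : Type*} [NonUnitalNonAssocRing Mag] [Module K Mag]
    (ι : V →ₗ[K] Mag) {B : Type*} [NonAssocRing B] [Module K B]
    (hB : ∀ f : V →ₗ[K] B,
      ∃! F : Mag →ₗ[K] B, (∀ x y : Mag, F (x * y) = F x * F y) ∧ F ∘ₗ ι = f)
    {f g : Unitization K Mag →ₗ[K] B} (hf₁ : f 1 = 1) (hg₁ : g 1 = 1)
    (hf : ∀ x y, f (x * y) = f x * f y) (hg : ∀ x y, g (x * y) = g x * g y)
    (h : ∀ v, f (inr (ι v)) = g (inr (ι v))) : f = g := by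
  have key : f ∘ₗ inrHom K K Mag = g ∘ₗ inrHom K K Mag :=
    (hB (g ∘ₗ inrHom K K Mag ∘ₗ ι)).unique
      ⟨fun x y => by simp [inr_mul, hf], LinearMap.ext fun v => by simpa using h v⟩
      ⟨fun x y => by simp [inr_mul, hg], LinearMap.ext fun v => by simp⟩
  refine LinearMap.ext fun x => ?_
  rw [linearMap_apply_eq f hf₁, linearMap_apply_eq g hg₁]
  congr 1
  exact LinearMap.congr_fun key x.snd

/-- On the unitization `H = K·1 ⊕ Mag(V)` of the free magmatic algebra on `V`, there is a
unique linear map `Δ : H → H ⊗ H` which sends `1` to `1 ⊗ 1`, is multiplicative for the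
componentwise product on `H ⊗ H`, and sends each `v ∈ V` to `v ⊗ 1 + 1 ⊗ v`; moreover any
such `Δ` is coassociative. -/
theorem free_magmatic_coproduct
    (K : Type u) [Field K] (V : Type u) [AddCommGroup V] [Module K V]
    (Mag : Type u) [NonUnitalNonAssocRing Mag] [Module K Mag]
    [SMulCommClass K Mag Mag] [IsScalarTower K Mag Mag]
    (ι : V →ₗ[K] Mag)
    (hfree : ∀ (A : Type u) [NonUnitalNonAssocRing A] [Module K A]
        [SMulCommClass K A A] [IsScalarTower K A A] (f : V →ₗ[K] A),
        ∃! F : Mag →ₗ[K] A, (∀ x y : Mag, F (x * y) = F x * F y) ∧ F ∘ₗ ι = f) :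
    (∃! Δ : Unitization K Mag →ₗ[K] Unitization K Mag ⊗[K] Unitization K Mag,
        Δ 1 = 1 ⊗ₜ[K] 1 ∧
        (∀ u v : Unitization K Mag, Δ (u * v) = Δ u * Δ v) ∧
        (∀ v : V, Δ (Unitization.inr (ι v))
          = (Unitization.inr (ι v) : Unitization K Mag) ⊗ₜ[K] 1
            + 1 ⊗ₜ[K] (Unitization.inr (ι v) : Unitization K Mag))) ∧
    (∀ Δ : Unitization K Mag →ₗ[K] Unitization K Mag ⊗[K] Unitization K Mag,
        (Δ 1 = 1 ⊗ₜ[K] 1 ∧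
          (∀ u v : Unitization K Mag, Δ (u * v) = Δ u * Δ v) ∧
          (∀ v : V, Δ (Unitization.inr (ι v))
            = (Unitization.inr (ι v) : Unitization K Mag) ⊗ₜ[K] 1
              + 1 ⊗ₜ[K] (Unitization.inr (ι v) : Unitization K Mag))) →
        (TensorProduct.assoc K (Unitization K Mag) (Unitization K Mag)
              (Unitization K Mag)).toLinearMap
            ∘ₗ TensorProduct.map Δ LinearMap.id ∘ₗ Δ
          = TensorProduct.map LinearMap.id Δ ∘ₗ Δ) := by
  refine ⟨?_, ?_⟩
  · let p : V →ₗ[K] Unitization K Mag ⊗[K] Unitization K Mag :=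
      ((TensorProduct.mk K (Unitization K Mag) (Unitization K Mag)).flip 1
        + TensorProduct.mk K (Unitization K Mag) (Unitization K Mag) 1)
        ∘ₗ Unitization.inrHom K K Mag ∘ₗ ι
    obtain ⟨F, ⟨hF, hFι⟩, -⟩ := hfree (Unitization K Mag ⊗[K] Unitization K Mag) p
    refine ⟨Unitization.extendUnital F,
      ⟨Unitization.extendUnital_one F, Unitization.extendUnital_mul F hF, fun v => ?_⟩, ?_⟩
    · rw [Unitization.extendUnital_inr]
      exact LinearMap.congr_fun hFι v
    · rintro Δ ⟨h₁, hmul, hι⟩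
      refine Unitization.linearMap_ext_of_free ι (hfree _) h₁ (Unitization.extendUnital_one F)
        hmul (Unitization.extendUnital_mul F hF) fun v => ?_
      rw [hι, Unitization.extendUnital_inr]
      exact (LinearMap.congr_fun hFι v).symm
  · rintro Δ ⟨h₁, hmul, hι⟩
    refine Unitization.linearMap_ext_of_free
      (B := Unitization K Mag ⊗[K] (Unitization K Mag ⊗[K] Unitization K Mag))
      ι (hfree _) ?_ ?_ ?_ ?_ fun v => ?_
    · simp only [LinearMap.comp_apply, h₁, TensorProduct.map_tmul, LinearMap.id_apply,
        LinearEquiv.coe_coe, TensorProduct.assoc_tmul]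
      rfl
    · simp only [LinearMap.comp_apply, h₁, TensorProduct.map_tmul, LinearMap.id_apply]
      rfl
    · intro x y
      simp only [LinearMap.comp_apply, LinearEquiv.coe_coe, hmul]
      rw [TensorProduct.map_map_mul Δ LinearMap.id hmul fun _ _ => rfl,
        TensorProduct.assoc_map_mul]
    · intro x y
      simp only [LinearMap.comp_apply, hmul]
      rw [TensorProduct.map_map_mul LinearMap.id Δ (fun _ _ => rfl) hmul]
    · simp only [LinearMap.comp_apply, LinearEquiv.coe_coe, hι, map_add, TensorProduct.map_tmul,
        LinearMap.id_apply, h₁, TensorProduct.add_tmul, TensorProduct.tmul_add,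
        TensorProduct.assoc_tmul]
      abel
end

section
/- Let K be a field and let H be a unital (not necessarily associative) K-algebra. Equip H ⊗_K H with the componentwise product and unit 1⊗1, and let Δ : H → H⊗H be a K-linear map with Δ(1) = 1⊗1 and Δ(uv) = Δ(u)Δ(v) for all u, v ∈ H. If x, y, z, t ∈ H are primitive (Δ(w) = w⊗1 + 1⊗w), then the element as(x, y, z·t) − z·as(x, y, t) − as(x, y, z)·t is primitive, where as(a,b,c) := (ab)c − a(bc). -/
open TensorProduct

/-- For a unital (not necessarily associative) algebra `H` with a multiplicative linear map
`Δ : H → H ⊗ H` sending `1` to `1 ⊗ 1`: if `x, y, z, t` are primitive then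
`as(x, y, z·t) − z·as(x, y, t) − as(x, y, z)·t` is primitive, where
`as(a,b,c) = (ab)c − a(bc)`. -/
theorem primitive_associator_combination
    (K : Type*) [Field K] (H : Type*) [NonAssocRing H] [Module K H]
    [SMulCommClass K H H] [IsScalarTower K H H]
    (Δ : H →ₗ[K] H ⊗[K] H)
    (hone : Δ 1 = 1 ⊗ₜ[K] 1)
    (hmul : ∀ u v : H, Δ (u * v) = Δ u * Δ v)
    (x y z t : H)
    (hx : Δ x = x ⊗ₜ[K] 1 + 1 ⊗ₜ[K] x)
    (hy : Δ y = y ⊗ₜ[K] 1 + 1 ⊗ₜ[K] y)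
    (hz : Δ z = z ⊗ₜ[K] 1 + 1 ⊗ₜ[K] z)
    (ht : Δ t = t ⊗ₜ[K] 1 + 1 ⊗ₜ[K] t) :
    Δ (((x * y) * (z * t) - x * (y * (z * t)))
        - z * ((x * y) * t - x * (y * t))
        - ((x * y) * z - x * (y * z)) * t)
      = (((x * y) * (z * t) - x * (y * (z * t)))
          - z * ((x * y) * t - x * (y * t))
          - ((x * y) * z - x * (y * z)) * t) ⊗ₜ[K] 1
        + 1 ⊗ₜ[K] (((x * y) * (z * t) - x * (y * (z * t)))
          - z * ((x * y) * t - x * (y * t))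
          - ((x * y) * z - x * (y * z)) * t) := by
  simp only [mul_sub, sub_mul, map_sub, hmul, hx, hy, hz, ht, mul_add, add_mul,
    Algebra.TensorProduct.tmul_mul_tmul, mul_one, one_mul,
    TensorProduct.sub_tmul, TensorProduct.tmul_sub]
  abel
end
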